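/- arXiv:2208.03476 — 5 statements merged into one kernel-verified Lean document; each statement's English description precedes it below -/
import Mathlib

section
/- Let (Ω, F, P) be a probability space with a filtration (F_k)_{k∈ℕ}, and let (B_k)_{k∈ℕ} be a sequence of nonnegative, integrable, adapted real-valued random variables. Suppose there exist constants 0 < κ < 1, ψ ≥ 0, γ ≥ 0 and λ > γ such that B_0 ≤ γ almost surely, E[B_{k+1} | F_k] ≤ κ B_k + ψ almost surely for every k, and λ ≥ ψ/(1 − κ). Then for every time horizon T ∈ ℕ, P( ∃ k with 0 ≤ k ≤ T such that B_k ≥ λ ) ≤ 1 − (1 − γ/λ)(1 − ψ/λ)^T. -/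
open MeasureTheory

/-- One-step estimate: restricted to an `m₀`-measurable event `s`, a drift `E[Y | m₀] ≤ κ X + ψ`
with `κ ≤ 1 - ψ/c` contracts the expected margin `1 - X/c` by at most the factor `1 - ψ/c`. -/
lemma mul_setIntegral_one_sub_div_le_of_condExp_le
    {Ω : Type*} {m₀ m : MeasurableSpace Ω} {μ : Measure Ω} [IsFiniteMeasure μ] (hm : m₀ ≤ m)
    {X Y : Ω → ℝ} (hX : Integrable X μ) (hY : Integrable Y μ) (hX0 : 0 ≤ᵐ[μ] X)
    {κ ψ c : ℝ} (hc : 0 < c) (hκ : κ ≤ 1 - ψ / c)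
    (hdrift : μ[Y | m₀] ≤ᵐ[μ] fun ω => κ * X ω + ψ)
    {s : Set Ω} (hs : MeasurableSet[m₀] s) :
    (1 - ψ / c) * ∫ ω in s, (1 - X ω / c) ∂μ ≤ ∫ ω in s, (1 - Y ω / c) ∂μ := by
  have hcond : ∫ ω in s, (1 - Y ω / c) ∂μ = ∫ ω in s, (1 - (μ[Y | m₀]) ω / c) ∂μ := by
    rw [integral_sub (integrable_const _) (hY.div_const c).integrableOn,
      integral_sub (integrable_const _) (integrable_condExp.div_const c).integrableOn,
      integral_div, integral_div, setIntegral_condExp hm hY hs]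
  rw [hcond, ← integral_const_mul]
  refine integral_mono_ae
    ((((integrable_const _).sub (hX.div_const c)).const_mul _).integrableOn)
    (((integrable_const _).sub (integrable_condExp.div_const c)).integrableOn)
    (ae_restrict_of_ae ?_)
  filter_upwards [hdrift, hX0] with ω hd h0
  have hd' : (μ[Y | m₀]) ω / c ≤ κ * (X ω / c) + ψ / c := by
    rw [← mul_div_assoc, ← add_div]
    exact div_le_div_of_nonneg_right hd hc.le
  have hmul : κ * (X ω / c) ≤ (1 - ψ / c) * (X ω / c) :=
    mul_le_mul_of_nonneg_right hκ (div_nonneg h0 hc.le)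
  linarith

/-- The event that an adapted process stays below `c` up to time `k` is known at time `k`. -/
lemma measurableSet_forall_le_lt_of_adapted
    {Ω : Type*} {m : MeasurableSpace Ω} {ℱ : Filtration ℕ m} {B : ℕ → Ω → ℝ}
    (hB : Adapted ℱ B) (c : ℝ) (k : ℕ) : MeasurableSet[ℱ k] {ω | ∀ j ≤ k, B j ω < c} := by
  simp only [Set.ofPred_forall]
  refine MeasurableSet.iInter fun j => MeasurableSet.iInter fun hj => ?_
  exact ℱ.mono hj _ (hB j measurableSet_Iio)

/-- Kushner-type finite-horizon safety bound, first case (`λ ≥ ψ/(1-κ)`):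
for a nonnegative, integrable, adapted process `B` with `B 0 ≤ γ` a.s. and drift
`E[B (k+1) | ℱ k] ≤ κ B k + ψ` a.s., the probability that `B k ≥ λ` for some `k ≤ T`
is at most `1 - (1 - γ/λ)(1 - ψ/λ)^T`. -/
theorem safety_probability_bound_case_one
    {Ω : Type*} {m : MeasurableSpace Ω} {μ : Measure Ω} [IsProbabilityMeasure μ]
    (ℱ : Filtration ℕ m) (B : ℕ → Ω → ℝ)
    (hadapted : Adapted ℱ B)
    (hnonneg : ∀ k, 0 ≤ᵐ[μ] B k)
    (hint : ∀ k, Integrable (B k) μ)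
    (κ ψ γ lam : ℝ) (hκ0 : 0 < κ) (hκ1 : κ < 1) (hψ : 0 ≤ ψ) (hγ : 0 ≤ γ)
    (hγlam : γ < lam)
    (hB0 : ∀ᵐ ω ∂μ, B 0 ω ≤ γ)
    (hdrift : ∀ k, μ[B (k + 1) | ℱ k] ≤ᵐ[μ] fun ω => κ * B k ω + ψ)
    (hcase : ψ / (1 - κ) ≤ lam) :
    ∀ T : ℕ, μ {ω | ∃ k ≤ T, lam ≤ B k ω}
      ≤ ENNReal.ofReal (1 - (1 - γ / lam) * (1 - ψ / lam) ^ T) := by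
  intro T
  have hlam : 0 < lam := hγ.trans_lt hγlam
  have hκa : κ ≤ 1 - ψ / lam := by
    have h : ψ / lam ≤ 1 - κ := by
      rw [div_le_iff₀ (sub_pos.2 hκ1)] at hcase
      rw [div_le_iff₀ hlam]
      linarith
    linarith
  have hsafe : ∀ k, MeasurableSet {ω | ∀ j ≤ k, B j ω < lam} := fun k =>
    ℱ.le k _ (measurableSet_forall_le_lt_of_adapted hadapted lam k)
  have hmargin : ∀ k, Integrable (fun ω => 1 - B k ω / lam) μ := fun k =>
    (integrable_const _).sub ((hint k).div_const lam)
  have hlower : ∀ k, (1 - γ / lam) * (1 - ψ / lam) ^ k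
      ≤ ∫ ω in {ω | ∀ j ≤ k, B j ω < lam}, (1 - B k ω / lam) ∂μ := by
    intro k
    induction k with
    | zero =>
      have huniv : {ω | ∀ j ≤ 0, B j ω < lam} =ᵐ[μ] Set.univ := by
        filter_upwards [hB0] with ω h
        refine eq_true fun j hj => ?_
        obtain rfl := Nat.le_zero.1 hj
        exact h.trans_lt hγlam
      rw [setIntegral_congr_set huniv, setIntegral_univ, pow_zero, mul_one]
      calc 1 - γ / lam = ∫ _, (1 - γ / lam) ∂μ := by simp
        _ ≤ _ := by
          refine integral_mono_ae (integrable_const _) (hmargin 0) ?_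
          filter_upwards [hB0] with ω h
          exact sub_le_sub_left (div_le_div_of_nonneg_right h hlam.le) 1
    | succ k ih =>
      calc (1 - γ / lam) * (1 - ψ / lam) ^ (k + 1)
          = (1 - ψ / lam) * ((1 - γ / lam) * (1 - ψ / lam) ^ k) := by ring
        _ ≤ (1 - ψ / lam) * ∫ ω in {ω | ∀ j ≤ k, B j ω < lam}, (1 - B k ω / lam) ∂μ :=
          mul_le_mul_of_nonneg_left ih (hκ0.le.trans hκa)
        _ ≤ ∫ ω in {ω | ∀ j ≤ k, B j ω < lam}, (1 - B (k + 1) ω / lam) ∂μ :=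
          mul_setIntegral_one_sub_div_le_of_condExp_le (ℱ.le k) (hint k) (hint (k + 1))
            (hnonneg k) hlam hκa (hdrift k)
            (measurableSet_forall_le_lt_of_adapted hadapted lam k)
        _ ≤ _ := by
          rw [← integral_indicator (hsafe k), ← integral_indicator (hsafe (k + 1))]
          refine integral_mono ((hmargin _).indicator (hsafe k))
            ((hmargin _).indicator (hsafe (k + 1))) fun ω => ?_
          by_cases hk : ∀ j ≤ k, B j ω < lam
          · by_cases hk' : B (k + 1) ω < lam
            · have hall : ∀ j ≤ k + 1, B j ω < lam := fun j hj =>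
                (Nat.le_succ_iff.1 hj).elim (hk j) fun h => h ▸ hk'
              rw [Set.indicator_of_mem (by exact hk), Set.indicator_of_mem (by exact hall)]
            · have hnot : ¬ ∀ j ≤ k + 1, B j ω < lam := fun h => hk' (h _ le_rfl)
              rw [Set.indicator_of_mem (by exact hk), Set.indicator_of_notMem (by exact hnot)]
              exact sub_nonpos.2 ((one_le_div₀ hlam).2 (not_lt.1 hk'))
          · have hnot : ¬ ∀ j ≤ k + 1, B j ω < lam := fun h =>
              hk fun j hj => h j (hj.trans k.le_succ)
            rw [Set.indicator_of_notMem (by exact hk), Set.indicator_of_notMem (by exact hnot)]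
  have hupper : ∫ ω in {ω | ∀ j ≤ T, B j ω < lam}, (1 - B T ω / lam) ∂μ
      ≤ μ.real {ω | ∀ j ≤ T, B j ω < lam} := by
    calc _ ≤ ∫ _ in {ω | ∀ j ≤ T, B j ω < lam}, (1 : ℝ) ∂μ := by
          refine integral_mono_ae (hmargin T).integrableOn (integrable_const _)
            (ae_restrict_of_ae ?_)
          filter_upwards [hnonneg T] with ω h
          exact sub_le_self 1 (div_nonneg h hlam.le)
      _ = _ := by simp
  have hcompl : {ω | ∃ k ≤ T, lam ≤ B k ω} = {ω | ∀ j ≤ T, B j ω < lam}ᶜ := by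
    ext ω
    simp
  rw [hcompl, ← ofReal_measureReal, probReal_compl_eq_one_sub (hsafe T)]
  exact ENNReal.ofReal_le_ofReal (sub_le_sub_left ((hlower T).trans hupper) 1)
end

section
/- Let (Ω, F, P) be a probability space with a filtration (F_k)_{k∈ℕ}, and let (B_k)_{k∈ℕ} be a sequence of nonnegative, integrable, adapted real-valued random variables. Suppose there exist constants 0 < κ < 1, ψ ≥ 0, γ ≥ 0 and λ > γ such that B_0 ≤ γ almost surely, E[B_{k+1} | F_k] ≤ κ B_k + ψ almost surely for every k, and λ < ψ/(1 − κ). Then for every time horizon T ∈ ℕ, P( ∃ k with 0 ≤ k ≤ T such that B_k ≥ λ ) ≤ (γ/λ) κ^T + (ψ/((1 − κ) λ)) (1 − κ^T). -/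
open MeasureTheory

/-- The event that the process `B` reaches the level `a` by time `n`. -/
def hitBy {Ω : Type*} (B : ℕ → Ω → ℝ) (a : ℝ) (n : ℕ) : Set Ω :=
  {ω | ∃ k ≤ n, a ≤ B k ω}

theorem hitBy_subset_succ {Ω : Type*} (B : ℕ → Ω → ℝ) (a : ℝ) (n : ℕ) :
    hitBy B a n ⊆ hitBy B a (n + 1) :=
  fun _ ⟨k, hk, h⟩ => ⟨k, hk.trans n.le_succ, h⟩

theorem le_of_mem_hitBy_succ_diff {Ω : Type*} {B : ℕ → Ω → ℝ} {a : ℝ} {n : ℕ} {ω : Ω}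
    (h : ω ∈ hitBy B a (n + 1) \ hitBy B a n) : a ≤ B (n + 1) ω := by
  obtain ⟨⟨k, hk, hak⟩, hn⟩ := h
  rcases Nat.le_succ_iff.mp hk with hk' | rfl
  · exact absurd ⟨k, hk', hak⟩ hn
  · exact hak

theorem measurableSet_hitBy {Ω : Type*} {m : MeasurableSpace Ω} {ℱ : Filtration ℕ m}
    {B : ℕ → Ω → ℝ} (hB : Adapted ℱ B) (a : ℝ) (n : ℕ) :
    MeasurableSet[ℱ n] (hitBy B a n) := by
  have h : hitBy B a n = ⋃ k ∈ Set.Iic n, B k ⁻¹' Set.Ici a := by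
    ext ω
    simp [hitBy]
  rw [h]
  exact MeasurableSet.biUnion (Set.to_countable _) fun k hk =>
    ℱ.mono hk _ (hB k measurableSet_Ici)

/-- The expectation of `B` frozen at the value `a` once it has reached the level `a`. -/
noncomputable def frozenMean {Ω : Type*} {m : MeasurableSpace Ω} (μ : Measure Ω)
    (B : ℕ → Ω → ℝ) (a : ℝ) (n : ℕ) : ℝ :=
  ∫ ω in (hitBy B a n)ᶜ, B n ω ∂μ + a * μ.real (hitBy B a n)

/-- The frozen mean inherits the affine drift of `B` when the level lies below the fixed point
of the drift. -/
theorem frozenMean_succ_le {Ω : Type*} {m : MeasurableSpace Ω} {μ : Measure Ω}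
    [IsProbabilityMeasure μ] {ℱ : Filtration ℕ m} {B : ℕ → Ω → ℝ} (hB : Adapted ℱ B)
    (hint : ∀ k, Integrable (B k) μ) {κ ψ a : ℝ} (ha : a ≤ κ * a + ψ) (n : ℕ)
    (hdrift : μ[B (n + 1) | ℱ n] ≤ᵐ[μ] fun ω => κ * B n ω + ψ) :
    frozenMean μ B a (n + 1) ≤ κ * frozenMean μ B a n + ψ := by
  have hn' := measurableSet_hitBy hB a n
  have hn : MeasurableSet (hitBy B a n) := ℱ.le n _ hn'
  have hs : MeasurableSet (hitBy B a (n + 1)) := ℱ.le _ _ (measurableSet_hitBy hB a (n + 1))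
  have hsub := hitBy_subset_succ B a n
  have hdrop : ∫ ω in (hitBy B a n)ᶜ, B (n + 1) ω ∂μ
      ≤ κ * ∫ ω in (hitBy B a n)ᶜ, B n ω ∂μ + ψ * (1 - μ.real (hitBy B a n)) := by
    rw [← setIntegral_condExp (ℱ.le n) (hint (n + 1)) hn'.compl]
    refine (setIntegral_mono_ae integrable_condExp.integrableOn
      (((hint n).const_mul κ).add (integrable_const ψ)).integrableOn hdrift).trans_eq ?_
    simp only [Pi.add_apply]
    rw [integral_add ((hint n).const_mul κ).integrableOn (integrable_const ψ).integrableOn,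
      integral_const_mul, setIntegral_const, probReal_compl_eq_one_sub hn, smul_eq_mul,
      mul_comm ψ]
  have hunion : (hitBy B a n)ᶜ
      = (hitBy B a (n + 1))ᶜ ∪ (hitBy B a (n + 1) \ hitBy B a n) := by
    ext ω
    have := @hsub ω
    simp only [Set.mem_compl_iff, Set.mem_union, Set.mem_sdiff]
    tauto
  have hsplit : ∫ ω in (hitBy B a n)ᶜ, B (n + 1) ω ∂μ
      = ∫ ω in (hitBy B a (n + 1))ᶜ, B (n + 1) ω ∂μ
        + ∫ ω in hitBy B a (n + 1) \ hitBy B a n, B (n + 1) ω ∂μ := by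
    conv_lhs => rw [hunion]
    exact setIntegral_union (disjoint_compl_left.mono_right Set.sdiff_subset) (hs.diff hn)
      (hint _).integrableOn (hint _).integrableOn
  have hnew : a * (μ.real (hitBy B a (n + 1)) - μ.real (hitBy B a n))
      ≤ ∫ ω in hitBy B a (n + 1) \ hitBy B a n, B (n + 1) ω ∂μ := by
    rw [← measureReal_sdiff hsub hn, mul_comm, ← smul_eq_mul, ← setIntegral_const]
    exact setIntegral_mono_on (integrable_const a).integrableOn (hint _).integrableOn
      (hs.diff hn) fun ω hω => le_of_mem_hitBy_succ_diff hω
  have hp : 0 ≤ μ.real (hitBy B a n) := measureReal_nonneg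
  unfold frozenMean
  nlinarith [mul_nonneg hp (sub_nonneg.mpr ha)]

theorem frozenMean_zero_le {Ω : Type*} {m : MeasurableSpace Ω} {μ : Measure Ω}
    [IsProbabilityMeasure μ] {B : ℕ → Ω → ℝ} (hnonneg : 0 ≤ᵐ[μ] B 0)
    (hint : Integrable (B 0) μ) {γ a : ℝ} (hγa : γ < a) (hB0 : ∀ᵐ ω ∂μ, B 0 ω ≤ γ) :
    frozenMean μ B a 0 ≤ γ := by
  have hnull : μ (hitBy B a 0) = 0 := by
    refine measure_mono_null ?_ (ae_iff.mp hB0)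
    rintro ω ⟨k, hk, h⟩
    obtain rfl := Nat.le_zero.mp hk
    exact not_le.mpr (hγa.trans_le h)
  have hle : ∫ ω, B 0 ω ∂μ ≤ γ := by
    simpa using integral_mono_ae hint (integrable_const γ) hB0
  rw [frozenMean, measureReal_def, hnull, ENNReal.toReal_zero, mul_zero, add_zero]
  exact (setIntegral_le_integral hint hnonneg).trans hle

/-- A sequence with affine drift is dominated by the solution of the affine recursion. -/
theorem le_of_affine_drift {s : ℕ → ℝ} {κ ψ γ : ℝ} (hκ0 : 0 ≤ κ) (hκ1 : κ < 1)
    (h0 : s 0 ≤ γ) (hs : ∀ n, s (n + 1) ≤ κ * s n + ψ) (n : ℕ) :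
    s n ≤ γ * κ ^ n + ψ / (1 - κ) * (1 - κ ^ n) := by
  have hne : 1 - κ ≠ 0 := (sub_pos.mpr hκ1).ne'
  induction n with
  | zero => simpa using h0
  | succ n ih =>
    calc s (n + 1) ≤ κ * s n + ψ := hs n
      _ ≤ κ * (γ * κ ^ n + ψ / (1 - κ) * (1 - κ ^ n)) + ψ := by gcongr
      _ = γ * κ ^ (n + 1) + ψ / (1 - κ) * (1 - κ ^ (n + 1)) := by
        field_simp
        ring

/-- Kushner-type finite-horizon safety bound, second case (`λ < ψ/(1-κ)`):
for a nonnegative, integrable, adapted process `B` with `B 0 ≤ γ` a.s. and drift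
`E[B (k+1) | ℱ k] ≤ κ B k + ψ` a.s., the probability that `B k ≥ λ` for some `k ≤ T`
is at most `(γ/λ)κ^T + (ψ/((1-κ)λ))(1-κ^T)`. -/
theorem safety_probability_bound_case_two
    {Ω : Type*} {m : MeasurableSpace Ω} {μ : Measure Ω} [IsProbabilityMeasure μ]
    (ℱ : Filtration ℕ m) (B : ℕ → Ω → ℝ)
    (hadapted : Adapted ℱ B)
    (hnonneg : ∀ k, 0 ≤ᵐ[μ] B k)
    (hint : ∀ k, Integrable (B k) μ)
    (κ ψ γ lam : ℝ) (hκ0 : 0 < κ) (hκ1 : κ < 1) (hψ : 0 ≤ ψ) (hγ : 0 ≤ γ)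
    (hγlam : γ < lam)
    (hB0 : ∀ᵐ ω ∂μ, B 0 ω ≤ γ)
    (hdrift : ∀ k, μ[B (k + 1) | ℱ k] ≤ᵐ[μ] fun ω => κ * B k ω + ψ)
    (hcase : lam < ψ / (1 - κ)) :
    ∀ T : ℕ, μ {ω | ∃ k ≤ T, lam ≤ B k ω}
      ≤ ENNReal.ofReal ((γ / lam) * κ ^ T + (ψ / ((1 - κ) * lam)) * (1 - κ ^ T)) := by
  intro T
  have hlam : 0 < lam := hγ.trans_lt hγlam
  have hκ : 0 < 1 - κ := sub_pos.mpr hκ1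
  have hfix : lam ≤ κ * lam + ψ := by
    rw [lt_div_iff₀ hκ] at hcase
    linarith
  have hmean := le_of_affine_drift (s := frozenMean μ B lam) hκ0.le hκ1
    (frozenMean_zero_le (hnonneg 0) (hint 0) hγlam hB0)
    (fun n => frozenMean_succ_le hadapted hint hfix n (hdrift n)) T
  have hrest : 0 ≤ ∫ ω in (hitBy B lam T)ᶜ, B T ω ∂μ :=
    setIntegral_nonneg_of_ae (hnonneg T)
  have hmarkov : lam * μ.real (hitBy B lam T) ≤ frozenMean μ B lam T :=
    le_add_of_nonneg_left hrest
  change μ (hitBy B lam T) ≤ _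
  rw [← ofReal_measureReal]
  refine ENNReal.ofReal_le_ofReal ?_
  have heq : γ / lam * κ ^ T + ψ / ((1 - κ) * lam) * (1 - κ ^ T)
      = (γ * κ ^ T + ψ / (1 - κ) * (1 - κ ^ T)) / lam := by
    field_simp
  rw [heq, le_div_iff₀ hlam, mul_comm]
  exact hmarkov.trans hmean
end

section
/- Let S be a standard Borel space, let K be a Markov kernel from S to S, and let (Z_k)_{k∈ℕ} be the Markov chain with transition kernel K started from a point a ∈ S (i.e., the coordinate process under the Ionescu–Tulcea measure generated by K from the Dirac measure at a). Let B : S → [0, ∞) be a bounded measurable function and suppose there exist constants 0 < κ < 1 and ψ ≥ 0 such that ∫ B(s') K(s, ds') ≤ κ B(s) + ψ for every s ∈ S. Let U ⊆ S be a measurable set and λ > 0 a constant with B(s) ≥ λ for all s ∈ U, and suppose B(a) ≤ γ for a constant γ with λ > γ and λ ≥ ψ/(1 − κ). Then for every T ∈ ℕ, the probability that Z_k ∈ U for some 0 ≤ k ≤ T is at most 1 − (1 − γ/λ)(1 − ψ/λ)^T. -/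
open MeasureTheory ProbabilityTheory

/-- A one-step inequality `c * g s ≤ ∫ g dK(s)` for a bounded measurable function `g` vanishing on
`U` propagates along a Markov chain with transition kernel `K` killed on entering `U`. -/
lemma pow_mul_integral_le_setIntegral_avoid
    {S : Type*} [MeasurableSpace S] (K : Kernel S S)
    {Ω : Type*} {mΩ : MeasurableSpace Ω} (μ : Measure Ω) [IsFiniteMeasure μ]
    (ℱ : Filtration ℕ mΩ) (Z : ℕ → Ω → S) (hadapted : ∀ k, Measurable[ℱ k] (Z k))
    (g : S → ℝ) (hg : Measurable g) (hgbdd : ∃ C, ∀ s, |g s| ≤ C)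
    (hMarkov : ∀ k, μ[(fun ω => g (Z (k + 1) ω)) | ℱ k] =ᵐ[μ] fun ω => ∫ s, g s ∂(K (Z k ω)))
    (U : Set S) (hU : MeasurableSet U) (hgU : ∀ s ∈ U, g s = 0)
    (c : ℝ) (hc : 0 ≤ c) (hstep : ∀ s, c * g s ≤ ∫ s', g s' ∂(K s)) (T : ℕ) :
    c ^ T * ∫ ω, g (Z 0 ω) ∂μ ≤ ∫ ω in {ω | ∀ k ≤ T, Z k ω ∉ U}, g (Z T ω) ∂μ := by
  have hint (k : ℕ) : Integrable (fun ω => g (Z k ω)) μ := by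
    obtain ⟨C, hC⟩ := hgbdd
    exact .of_bound (hg.comp ((hadapted k).mono (ℱ.le k) le_rfl)).aestronglyMeasurable C
      (.of_forall fun ω => hC _)
  have hmeas (k : ℕ) : MeasurableSet[ℱ k] {ω | ∀ j ≤ k, Z j ω ∉ U} := by
    simp only [Set.ofPred_forall]
    exact .iInter fun j => .iInter fun hj => ℱ.mono hj _ (hadapted j hU.compl)
  induction T with
  | zero =>
    rw [pow_zero, one_mul, setIntegral_eq_integral_of_forall_compl_eq_zero]
    intro ω hω
    exact hgU _ (by simpa using hω)
  | succ k ih =>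
    calc c ^ (k + 1) * ∫ ω, g (Z 0 ω) ∂μ
        = c * (c ^ k * ∫ ω, g (Z 0 ω) ∂μ) := by ring
      _ ≤ c * ∫ ω in {ω | ∀ j ≤ k, Z j ω ∉ U}, g (Z k ω) ∂μ := by gcongr
      _ = ∫ ω in {ω | ∀ j ≤ k, Z j ω ∉ U}, c * g (Z k ω) ∂μ := (integral_const_mul _ _).symm
      _ ≤ ∫ ω in {ω | ∀ j ≤ k, Z j ω ∉ U}, ∫ s, g s ∂(K (Z k ω)) ∂μ :=
        integral_mono ((hint k).const_mul c).integrableOn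
          (integrable_condExp.congr (hMarkov k)).integrableOn fun ω => hstep _
      _ = ∫ ω in {ω | ∀ j ≤ k, Z j ω ∉ U}, (μ[(fun ω => g (Z (k + 1) ω)) | ℱ k]) ω ∂μ :=
        (integral_congr_ae (ae_restrict_of_ae (hMarkov k))).symm
      _ = ∫ ω in {ω | ∀ j ≤ k, Z j ω ∉ U}, g (Z (k + 1) ω) ∂μ :=
        setIntegral_condExp (ℱ.le k) (hint (k + 1)) (hmeas k)
      _ = ∫ ω in {ω | ∀ j ≤ k + 1, Z j ω ∉ U}, g (Z (k + 1) ω) ∂μ := by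
        refine setIntegral_eq_of_subset_of_forall_sdiff_eq_zero (ℱ.le k _ (hmeas k))
          (fun ω hω j hj => hω j (by lia)) fun ω hω => hgU _ ?_
        by_contra hnot
        refine hω.2 fun j hj => ?_
        rcases hj.lt_or_eq with hlt | rfl
        · exact hω.1 j (by lia)
        · exact hnot

/-- The drift condition on `B`, rewritten for the truncated function `max (1 - B / lam) 0`. -/
lemma mul_max_one_sub_div_le_integral {S : Type*} [MeasurableSpace S]
    (ν : Measure S) [IsProbabilityMeasure ν] (B : S → ℝ) (hB : Integrable B ν)
    (κ ψ lam : ℝ) (hlam : 0 < lam) (hκψ : ψ / lam ≤ 1 - κ)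
    (s : S) (hs : 0 ≤ B s) (hdrift : ∫ s', B s' ∂ν ≤ κ * B s + ψ) :
    (1 - ψ / lam) * max (1 - B s / lam) 0 ≤ ∫ s', max (1 - B s' / lam) 0 ∂ν := by
  rcases le_total (1 - B s / lam) 0 with h | h
  · rw [max_eq_right h, mul_zero]
    exact integral_nonneg fun _ => le_max_right _ _
  have hint : Integrable (fun s' => 1 - B s' / lam) ν := (integrable_const 1).sub (hB.div_const lam)
  have hb : 0 ≤ B s / lam := by positivity
  have hdiv : (∫ s', B s' ∂ν) / lam ≤ κ * (B s / lam) + ψ / lam := by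
    calc (∫ s', B s' ∂ν) / lam ≤ (κ * B s + ψ) / lam := by gcongr
      _ = κ * (B s / lam) + ψ / lam := by ring
  calc (1 - ψ / lam) * max (1 - B s / lam) 0
      ≤ 1 - (∫ s', B s' ∂ν) / lam := by
        rw [max_eq_left h]
        nlinarith
    _ = ∫ s', (1 - B s' / lam) ∂ν := by
        rw [integral_sub (integrable_const 1) (hB.div_const lam), integral_div]
        simp
    _ ≤ ∫ s', max (1 - B s' / lam) 0 ∂ν :=
        integral_mono hint (hint.sup (integrable_zero _ _ _)) fun _ => le_max_left _ _

/-- Kushner-type finite-horizon safety bound for a Markov chain, first case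
(`λ ≥ ψ/(1-κ)`). `Z` is a Markov chain on a standard Borel space `S` with Markov
transition kernel `K`, started from the point `a` (as given, e.g., by the coordinate
process under the Ionescu–Tulcea measure generated by `K` from the Dirac measure at
`a`); the Markov property is expressed via conditional expectations of bounded
measurable functions with respect to a filtration `ℱ` to which `Z` is adapted.
If a bounded measurable barrier certificate `B ≥ 0` satisfies the drift condition
`∫ B(s') K(s, ds') ≤ κ B s + ψ` for all `s`, is at least `lam` on the unsafe set `U`,
and `B a ≤ γ < lam` with `lam ≥ ψ/(1-κ)`, then the probability that the chain visits
`U` within time `T` is at most `1 - (1 - γ/lam)(1 - ψ/lam)^T`. -/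
theorem markov_chain_safety_bound_case_one
    {S : Type*} [MeasurableSpace S] [StandardBorelSpace S]
    (K : Kernel S S) [IsMarkovKernel K] (a : S)
    {Ω : Type*} {mΩ : MeasurableSpace Ω} (μ : Measure Ω) [IsProbabilityMeasure μ]
    (ℱ : Filtration ℕ mΩ) (Z : ℕ → Ω → S)
    (hadapted : ∀ k, Measurable[ℱ k] (Z k))
    (hZ0 : ∀ᵐ ω ∂μ, Z 0 ω = a)
    (hMarkov : ∀ (k : ℕ) (f : S → ℝ), Measurable f → (∃ C, ∀ s, |f s| ≤ C) →
      μ[(fun ω => f (Z (k + 1) ω)) | ℱ k] =ᵐ[μ] fun ω => ∫ s, f s ∂(K (Z k ω)))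
    (B : S → ℝ) (hBmeas : Measurable B) (hBnonneg : ∀ s, 0 ≤ B s)
    (hBbdd : ∃ C, ∀ s, B s ≤ C)
    (κ ψ : ℝ) (hκ0 : 0 < κ) (hκ1 : κ < 1) (hψ : 0 ≤ ψ)
    (hdrift : ∀ s, ∫ s', B s' ∂(K s) ≤ κ * B s + ψ)
    (U : Set S) (hU : MeasurableSet U)
    (lam γ : ℝ) (hlam : 0 < lam)
    (hBU : ∀ s ∈ U, lam ≤ B s)
    (ha : B a ≤ γ) (hγlam : γ < lam)
    (hcase : ψ / (1 - κ) ≤ lam) :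
    ∀ T : ℕ, μ {ω | ∃ k ≤ T, Z k ω ∈ U}
      ≤ ENNReal.ofReal (1 - (1 - γ / lam) * (1 - ψ / lam) ^ T) := by
  intro T
  obtain ⟨C, hC⟩ := hBbdd
  have hκψ : ψ / lam ≤ 1 - κ := by
    rw [div_le_iff₀ (by linarith)] at hcase
    rw [div_le_iff₀ hlam]
    linarith
  set g : S → ℝ := fun s => max (1 - B s / lam) 0
  have hg : Measurable g := by fun_prop
  have hg0 (s : S) : 0 ≤ g s := le_max_right _ _
  have hg1 (s : S) : g s ≤ 1 :=
    max_le (sub_le_self _ (div_nonneg (hBnonneg s) hlam.le)) zero_le_one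
  have hgbdd : ∃ C, ∀ s, |g s| ≤ C := ⟨1, fun s => by rw [abs_of_nonneg (hg0 s)]; exact hg1 s⟩
  have hgU (s : S) (hs : s ∈ U) : g s = 0 :=
    max_eq_right (sub_nonpos.2 ((one_le_div hlam).2 (hBU s hs)))
  have hBint (s : S) : Integrable B (K s) :=
    .of_bound hBmeas.aestronglyMeasurable C
      (.of_forall fun s => by rw [Real.norm_of_nonneg (hBnonneg s)]; exact hC s)
  have hZ (k : ℕ) : Measurable (Z k) := (hadapted k).mono (ℱ.le k) le_rfl
  have hlower := pow_mul_integral_le_setIntegral_avoid K μ ℱ Z hadapted g hg hgbdd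
    (fun k => hMarkov k g hg hgbdd) U hU hgU (1 - ψ / lam) (by linarith)
    (fun s => mul_max_one_sub_div_le_integral (K s) B (hBint s) κ ψ lam hlam hκψ s
      (hBnonneg s) (hdrift s)) T
  have hinit : 1 - γ / lam ≤ ∫ ω, g (Z 0 ω) ∂μ := by
    have : ∫ ω, g (Z 0 ω) ∂μ = g a := by
      rw [integral_congr_ae (hZ0.mono fun ω hω => congrArg g hω)]
      simp
    rw [this]
    exact (by gcongr : 1 - γ / lam ≤ 1 - B a / lam).trans (le_max_left _ _)
  have hupper : ∫ ω in {ω | ∀ k ≤ T, Z k ω ∉ U}, g (Z T ω) ∂μ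
      ≤ μ.real {ω | ∀ k ≤ T, Z k ω ∉ U} := by
    calc ∫ ω in {ω | ∀ k ≤ T, Z k ω ∉ U}, g (Z T ω) ∂μ
        ≤ ∫ ω in {ω | ∀ k ≤ T, Z k ω ∉ U}, (1 : ℝ) ∂μ :=
          integral_mono_of_nonneg (.of_forall fun _ => hg0 _) (integrable_const 1)
            (.of_forall fun _ => hg1 _)
      _ = μ.real {ω | ∀ k ≤ T, Z k ω ∉ U} := by simp
  have hmeas : MeasurableSet {ω | ∀ k ≤ T, Z k ω ∉ U} := by
    simp only [Set.ofPred_forall]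
    exact .iInter fun k => .iInter fun _ => hZ k hU.compl
  have hcompl : {ω | ∃ k ≤ T, Z k ω ∈ U} = {ω | ∀ k ≤ T, Z k ω ∉ U}ᶜ := by
    ext ω
    simp
  rw [hcompl, ← ofReal_measureReal, probReal_compl_eq_one_sub hmeas]
  apply ENNReal.ofReal_le_ofReal
  have hpow : 0 ≤ (1 - ψ / lam) ^ T := pow_nonneg (by linarith) T
  linarith [mul_le_mul_of_nonneg_left hinit hpow]
end

section
/- Fix N ∈ ℕ with N ≥ 1, nonempty finite mode sets P_1, …, P_N, weights μ_1, …, μ_N > 0, sets X_i ⊆ ℝ^{n_i} and W_i ⊆ ℝ^{p̄_i}, maps h_i : ℝ^{n_i} → ℝ^{q_i}, and for each i and p_i ∈ P_i: a function B_{i p_i} : ℝ^{n_i} → [0, ∞), a function D_{i p_i} : ℝ^{n_i} × ℝ^{p̄_i} → ℝ, constants 0 < κ_{i p_i} < 1 and ψ_{i p_i} ≥ 0, and a symmetric matrix X_i of size (p̄_i + q_i) × (p̄_i + q_i), such that for all x_i ∈ X_i and all w_i ∈ W_i: D_{i p_i}(x_i, w_i) ≤ κ_{i p_i} B_{i p_i}(x_i)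 + ψ_{i p_i} + [w_i; h_i(x_i)]^T X_i [w_i; h_i(x_i)]. Let M be a real (Σ_i p̄_i) × (Σ_i q_i) matrix, let X_cmp be the symmetric matrix built from the blocks μ_i X_i^{l l̄} (block-diagonal in each of the four block positions, as in equation (12) of the paper with the weights μ_i included), and assume [M; I]^T X_cmp [M; I] ⪯ 0. Define κ = max_i max_{p_i ∈ P_i} κ_{i p_i} and ψ = Σ_{i=1}^N μ_i max_{p_i ∈ P_i} ψ_{i p_i}. Then for every p = (p_1, …, p_N) and every x = [x_1; …; x_N] with x_i ∈ X_i for all i, if the vector w = [w_1; …; w_N] := M [h_1(x_1); …; h_N(x_N)] satisfies w_i ∈ W_i for all i, then Σ_{i=1}^N μ_i D_{i p_i}(x_i, w_i) ≤ κ · Σ_{i=1}^N μ_i B_{i p_i}(x_i) + ψ. -/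
open Matrix

/-- The bilinear form of a block-diagonal matrix is the sum of the forms of its blocks. -/
lemma dotProduct_blockDiagonal'_mulVec {ι R : Type*} [Fintype ι] [DecidableEq ι]
    [NonUnitalNonAssocSemiring R] {m n : ι → Type*} [∀ i, Fintype (m i)] [∀ i, Fintype (n i)]
    (A : ∀ i, Matrix (m i) (n i) R) (v : (Σ i, m i) → R) (u : (Σ i, n i) → R) :
    v ⬝ᵥ blockDiagonal' A *ᵥ u =
      ∑ i, (fun a => v ⟨i, a⟩) ⬝ᵥ A i *ᵥ (fun b => u ⟨i, b⟩) := by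
  simp only [dotProduct, mulVec, Fintype.sum_sigma]
  refine Finset.sum_congr rfl fun i _ => Finset.sum_congr rfl fun a _ => ?_
  congr 1
  rw [Finset.sum_eq_single i]
  · simp
  · intro j _ hj
    simp [blockDiagonal'_apply_ne A _ _ hj.symm]
  · simp

/-- The quadratic form of the block matrix assembled from the weighted blocks `μ i • X i` is the
weighted sum of the quadratic forms of the `X i`. -/
lemma dotProduct_fromBlocks_blockDiagonal'_mulVec {ι R : Type*} [Fintype ι] [DecidableEq ι]
    [CommSemiring R] {m n : ι → Type*} [∀ i, Fintype (m i)] [∀ i, Fintype (n i)]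
    (μ : ι → R) (X : ∀ i, Matrix (m i ⊕ n i) (m i ⊕ n i) R)
    (w : (Σ i, m i) → R) (y : (Σ i, n i) → R) :
    Sum.elim w y ⬝ᵥ fromBlocks
        (blockDiagonal' fun i => μ i • (X i).toBlocks₁₁)
        (blockDiagonal' fun i => μ i • (X i).toBlocks₁₂)
        (blockDiagonal' fun i => μ i • (X i).toBlocks₂₁)
        (blockDiagonal' fun i => μ i • (X i).toBlocks₂₂) *ᵥ Sum.elim w y =
      ∑ i, μ i * (Sum.elim (fun a => w ⟨i, a⟩) (fun b => y ⟨i, b⟩) ⬝ᵥ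
        X i *ᵥ Sum.elim (fun a => w ⟨i, a⟩) (fun b => y ⟨i, b⟩)) := by
  have key (i : ι) := congrArg
    (fun Z => Sum.elim (fun a => w ⟨i, a⟩) (fun b => y ⟨i, b⟩) ⬝ᵥ
      Z *ᵥ Sum.elim (fun a => w ⟨i, a⟩) (fun b => y ⟨i, b⟩)) (fromBlocks_toBlocks (X i)).symm
  simp only [fromBlocks_mulVec, Sum.elim_comp_inl, Sum.elim_comp_inr,
    sumElim_dotProduct_sumElim, dotProduct_add] at key ⊢
  simp only [key, dotProduct_blockDiagonal'_mulVec, smul_mulVec, dotProduct_smul, smul_eq_mul,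
    mul_add, Finset.sum_add_distrib]

/-- Drift part of the compositionality theorem: if each subsystem's post-expectation
`D i p x w` satisfies the storage-certificate drift condition with supply rate
`[wᵢ; hᵢ(xᵢ)]ᵀ (X i) [wᵢ; hᵢ(xᵢ)]`, the interconnection is `w = M [h₁(x₁); …; h_N(x_N)]`,
and the dissipativity LMI `[M; I]ᵀ X_cmp [M; I] ⪯ 0` holds (with `X_cmp` built
block-diagonally from the weighted blocks `μ i • X i`), then the weighted sum of the
post-expectations satisfies the composite drift condition with
`κ = max_{i, p} κm i p` and `ψ = ∑ i, μ i * max_p ψm i p`. -/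
theorem composite_barrier_drift
    (N : ℕ) (hN : 0 < N) (n pb q : Fin N → ℕ)
    (P : Fin N → Type) [∀ i, Fintype (P i)] [∀ i, Nonempty (P i)]
    (μ : Fin N → ℝ) (hμ : ∀ i, 0 < μ i)
    (Xset : ∀ i, Set (Fin (n i) → ℝ)) (Wset : ∀ i, Set (Fin (pb i) → ℝ))
    (h : ∀ i, (Fin (n i) → ℝ) → (Fin (q i) → ℝ))
    (B : ∀ i, P i → (Fin (n i) → ℝ) → ℝ) (hBnn : ∀ i p x, 0 ≤ B i p x)
    (D : ∀ i, P i → (Fin (n i) → ℝ) → (Fin (pb i) → ℝ) → ℝ)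
    (κm ψm : ∀ i, P i → ℝ)
    (hκm : ∀ i p, 0 < κm i p ∧ κm i p < 1)
    (hψm : ∀ i p, 0 ≤ ψm i p)
    (X : ∀ i, Matrix (Fin (pb i) ⊕ Fin (q i)) (Fin (pb i) ⊕ Fin (q i)) ℝ)
    (hXsymm : ∀ i, (X i).IsSymm)
    (hdrift : ∀ i (p : P i), ∀ x ∈ Xset i, ∀ w ∈ Wset i,
      D i p x w ≤ κm i p * B i p x + ψm i p +
        Sum.elim w (h i x) ⬝ᵥ (X i).mulVec (Sum.elim w (h i x)))
    (M : Matrix ((i : Fin N) × Fin (pb i)) ((i : Fin N) × Fin (q i)) ℝ)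
    (hLMI :
      (-((Matrix.fromRows M (1 : Matrix ((i : Fin N) × Fin (q i)) ((i : Fin N) × Fin (q i)) ℝ))ᵀ *
          (Matrix.fromBlocks
            (Matrix.blockDiagonal' fun i => μ i • (X i).toBlocks₁₁)
            (Matrix.blockDiagonal' fun i => μ i • (X i).toBlocks₁₂)
            (Matrix.blockDiagonal' fun i => μ i • (X i).toBlocks₂₁)
            (Matrix.blockDiagonal' fun i => μ i • (X i).toBlocks₂₂)) *
          Matrix.fromRows M (1 : Matrix ((i : Fin N) × Fin (q i)) ((i : Fin N) × Fin (q i)) ℝ))).PosSemidef) :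
    ∀ (p : ∀ i, P i) (x : ∀ i, Fin (n i) → ℝ), (∀ i, x i ∈ Xset i) →
      (∀ i, (fun a : Fin (pb i) => M.mulVec (fun j => h j.1 (x j.1) j.2) ⟨i, a⟩) ∈ Wset i) →
      ∑ i, μ i * D i (p i) (x i) (fun a : Fin (pb i) => M.mulVec (fun j => h j.1 (x j.1) j.2) ⟨i, a⟩)
        ≤ (Finset.univ.sup' ⟨⟨0, hN⟩, Finset.mem_univ _⟩ fun i =>
              Finset.univ.sup' (Finset.univ_nonempty (α := P i)) (κm i))
            * ∑ i, μ i * B i (p i) (x i)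
          + ∑ i, μ i * Finset.univ.sup' (Finset.univ_nonempty (α := P i)) (ψm i) := by
  intro p x hx hw
  set y : ((i : Fin N) × Fin (q i)) → ℝ := fun j => h j.1 (x j.1) j.2
  have hsupply : ∑ i, μ i * (Sum.elim (fun a => (M *ᵥ y) ⟨i, a⟩) (h i (x i)) ⬝ᵥ
      X i *ᵥ Sum.elim (fun a => (M *ᵥ y) ⟨i, a⟩) (h i (x i))) ≤ 0 := by
    have hnonneg := hLMI.dotProduct_mulVec_nonneg y
    rw [star_trivial, neg_mulVec, dotProduct_neg, ← mulVec_mulVec, ← mulVec_mulVec,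
      dotProduct_mulVec, vecMul_transpose, fromRows_mulVec, one_mulVec,
      dotProduct_fromBlocks_blockDiagonal'_mulVec] at hnonneg
    exact neg_nonneg.mp hnonneg
  set κ := Finset.univ.sup' ⟨⟨0, hN⟩, Finset.mem_univ _⟩ fun i =>
    Finset.univ.sup' (Finset.univ_nonempty (α := P i)) (κm i)
  have hκ (i : Fin N) : κm i (p i) ≤ κ :=
    (Finset.le_sup' (κm i) (Finset.mem_univ (p i))).trans
      (Finset.le_sup' (fun i => Finset.univ.sup' (Finset.univ_nonempty (α := P i)) (κm i))
        (Finset.mem_univ i))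
  have hterm (i : Fin N) : μ i * D i (p i) (x i) (fun a => (M *ᵥ y) ⟨i, a⟩) ≤
      κ * (μ i * B i (p i) (x i)) +
        μ i * Finset.univ.sup' (Finset.univ_nonempty (α := P i)) (ψm i) +
        μ i * (Sum.elim (fun a => (M *ᵥ y) ⟨i, a⟩) (h i (x i)) ⬝ᵥ
          X i *ᵥ Sum.elim (fun a => (M *ᵥ y) ⟨i, a⟩) (h i (x i))) := by
    rw [mul_left_comm κ, ← mul_add, ← mul_add]
    refine mul_le_mul_of_nonneg_left ((hdrift i (p i) _ (hx i) _ (hw i)).trans ?_) (hμ i).le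
    gcongr
    · exact hBnn i (p i) (x i)
    · exact hκ i
    · exact Finset.le_sup' (ψm i) (Finset.mem_univ (p i))
  have hsum := Finset.sum_le_sum fun i (_ : i ∈ Finset.univ) => hterm i
  rw [Finset.sum_add_distrib, Finset.sum_add_distrib, ← Finset.mul_sum] at hsum
  linarith
end

section
/- For N ∈ ℕ with N ≥ 3, let M be the N × N real symmetric matrix with entries M_{i,i+1} = M_{i+1,i} = 1 for i = 1, …, N−1, M_{1,N} = M_{N,1} = 1, and all other entries zero (the adjacency matrix of the N-cycle). Then the matrix 0.005 · M^T M − 0.003 · (M + M^T) − 0.035 · I_N is negative semidefinite; equivalently, for every x ∈ ℝ^N, 0.005 ‖M x‖₂² − 0.006 x^T M x − 0.035 ‖x‖₂² ≤ 0. -/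
open Matrix

/-- The adjacency matrix of a cycle acts by adding up the two cyclic neighbours. -/
lemma cycle_mulVec_apply {n : ℕ} (hn : 2 ≤ n) (M : Matrix (Fin (n + 1)) (Fin (n + 1)) ℝ)
    (hM : ∀ i j : Fin (n + 1), M i j =
      if (j.val = i.val + 1 ∨ i.val = j.val + 1 ∨
          (i.val = 0 ∧ j.val = n) ∨ (j.val = 0 ∧ i.val = n))
      then 1 else 0) (x : Fin (n + 1) → ℝ) (i : Fin (n + 1)) :
    (M *ᵥ x) i = x (finRotate (n + 1) i) + x ((finRotate (n + 1)).symm i) := by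
  have entry (j : Fin (n + 1)) : M i j = (if finRotate (n + 1) i = j then 1 else 0) +
      (if (finRotate (n + 1)).symm i = j then 1 else 0) := by
    have hi := coe_finRotate i
    have hj := coe_finRotate j
    simp only [Fin.ext_iff, Fin.val_last] at hi hj
    simp only [hM, Equiv.symm_apply_eq, Fin.ext_iff, hi, hj]
    have := i.isLt
    have := j.isLt
    split_ifs <;> first | omega | norm_num
  simp [mulVec, dotProduct, entry, add_mul, Finset.sum_add_distrib]

/-- The quadratic form bound for any matrix acting as a permutation plus its inverse. -/
lemma lmi_form_nonpos_of_mulVec_apply {ι : Type*} [Fintype ι] (M : Matrix ι ι ℝ)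
    (σ : Equiv.Perm ι) (x : ι → ℝ) (h : ∀ i, (M *ᵥ x) i = x (σ i) + x (σ.symm i)) :
    0.005 * (∑ i, (M.mulVec x i) ^ 2) - 0.006 * (x ⬝ᵥ M.mulVec x)
      - 0.035 * (∑ i, x i ^ 2) ≤ 0 := by
  have h₁ : ∑ i, x (σ i) ^ 2 = ∑ i, x i ^ 2 := Equiv.sum_comp σ (x · ^ 2)
  have h₂ : ∑ i, x (σ.symm i) ^ 2 = ∑ i, x i ^ 2 := Equiv.sum_comp σ.symm (x · ^ 2)
  have norm_le : ∑ i, (M *ᵥ x) i ^ 2 ≤ ∑ i, (2 * x (σ i) ^ 2 + 2 * x (σ.symm i) ^ 2) :=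
    Finset.sum_le_sum fun i _ => by
      rw [h]
      nlinarith [sq_nonneg (x (σ i) - x (σ.symm i))]
  have form_le : ∑ i, -(x i * (M *ᵥ x) i) ≤
      ∑ i, (x i ^ 2 + (1 / 2) * x (σ i) ^ 2 + (1 / 2) * x (σ.symm i) ^ 2) :=
    Finset.sum_le_sum fun i _ => by
      rw [h]
      nlinarith [sq_nonneg (x i + x (σ i)), sq_nonneg (x i + x (σ.symm i))]
  simp only [Finset.sum_add_distrib, ← Finset.mul_sum, Finset.sum_neg_distrib, h₁, h₂]
    at norm_le form_le
  have sum_nonneg : 0 ≤ ∑ i, x i ^ 2 := Finset.sum_nonneg fun i _ => sq_nonneg (x i)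
  simp only [dotProduct]
  linarith

/-- Verification of the compositional dissipativity LMI in the room-temperature case
study: for the adjacency matrix `M` of the `N`-cycle, the matrix
`0.005 Mᵀ M - 0.003 (M + Mᵀ) - 0.035 I` is negative semidefinite; equivalently
`0.005 ‖M x‖₂² - 0.006 xᵀ M x - 0.035 ‖x‖₂² ≤ 0` for all `x`. -/
theorem room_network_lmi
    (N : ℕ) (hN : 3 ≤ N)
    (M : Matrix (Fin N) (Fin N) ℝ)
    (hM : ∀ i j : Fin N, M i j =
      if (j.val = i.val + 1 ∨ i.val = j.val + 1 ∨
          (i.val = 0 ∧ j.val = N - 1) ∨ (j.val = 0 ∧ i.val = N - 1))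
      then 1 else 0) :
    (-((0.005 : ℝ) • (Mᵀ * M) - (0.003 : ℝ) • (M + Mᵀ) -
        (0.035 : ℝ) • (1 : Matrix (Fin N) (Fin N) ℝ))).PosSemidef ∧
    ∀ x : Fin N → ℝ,
      0.005 * (∑ i, (M.mulVec x i) ^ 2) - 0.006 * (x ⬝ᵥ M.mulVec x)
        - 0.035 * (∑ i, x i ^ 2) ≤ 0 := by
  have form (x : Fin N → ℝ) : 0.005 * (∑ i, (M.mulVec x i) ^ 2) - 0.006 * (x ⬝ᵥ M.mulVec x)
      - 0.035 * (∑ i, x i ^ 2) ≤ 0 := by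
    obtain ⟨n, rfl⟩ : ∃ n, N = n + 1 := ⟨N - 1, by omega⟩
    exact lmi_form_nonpos_of_mulVec_apply M (finRotate (n + 1)) x
      (cycle_mulVec_apply (by omega) M hM x)
  refine ⟨.of_dotProduct_mulVec_nonneg ?_ fun x => ?_, form⟩
  · simp [IsHermitian, conjTranspose_eq_transpose_of_trivial, add_comm]
  · have normSq : x ⬝ᵥ Mᵀ *ᵥ (M *ᵥ x) = ∑ i, (M *ᵥ x) i ^ 2 := by
      rw [dotProduct_mulVec, vecMul_transpose]
      simp [dotProduct, sq]
    have tr : x ⬝ᵥ Mᵀ *ᵥ x = x ⬝ᵥ M *ᵥ x := by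
      rw [dotProduct_mulVec, vecMul_transpose, dotProduct_comm]
    have self : x ⬝ᵥ x = ∑ i, x i ^ 2 := by simp [dotProduct, sq]
    simp only [star_trivial, neg_mulVec, sub_mulVec, smul_mulVec, add_mulVec, one_mulVec,
      dotProduct_neg, dotProduct_sub, dotProduct_smul, dotProduct_add, ← mulVec_mulVec,
      normSq, tr, self, smul_eq_mul]
    linarith [form x]
end
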